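/- Let D_1, …, D_m ⊆ ℝ^n be nonempty closed convex sets with D := ⋂_{i=1}^m D_i nonempty, let x_0 ∈ ℝ^n, and let (x_k) be the sequence of cyclic projections onto D_1, …, D_m starting at x_0. Let τ ∈ (0, 1], set r := 1/τ, and suppose c_0 > 1 is such that dist(x_k, D)^2 ≤ c_0·( Σ_{i=1}^m dist(x_k, D_i)^2 )^τ for all k ≥ 0. Then for every k ≥ 0: (1/c_0^r)·dist(x_k, D)^{2r} ≤ m^3·( dist(x_k, D)^2 − dist(x_{k+m}, D)^2 ). -/

import Mathlib

open Metric Set Filter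
open scoped BigOperators

noncomputable section

/-- Strengthened Fejér monotonicity of nearest-point maps onto convex sets. -/
theorem dist_sq_add_dist_sq_le_of_nearest {E : Type*} [NormedAddCommGroup E]
    [InnerProductSpace ℝ E] {K : Set E} (hK : Convex ℝ K) {u p y : E} (hp : p ∈ K)
    (hmin : ∀ w ∈ K, dist u p ≤ dist u w) (hy : y ∈ K) :
    dist p y ^ 2 + dist u p ^ 2 ≤ dist u y ^ 2 := by
  have hinf : ‖u - p‖ = ⨅ w : K, ‖u - w‖ := by
    have : Nonempty K := ⟨⟨p, hp⟩⟩
    refine le_antisymm (le_ciInf fun w => ?_) ?_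
    · simpa [dist_eq_norm] using hmin w w.2
    · exact ciInf_le (f := fun w : K => ‖u - w‖)
        ⟨0, by rintro _ ⟨w, rfl⟩; exact norm_nonneg _⟩ ⟨p, hp⟩
  have hinner := (norm_eq_iInf_iff_real_inner_le_zero hK hp).1 hinf y hy
  have hsq := norm_sub_sq_real (u - p) (y - p)
  rw [sub_sub_sub_cancel_right] at hsq
  rw [dist_comm p y, dist_eq_norm, dist_eq_norm, dist_eq_norm]
  linarith

/-- One nearest-point step decreases the squared distance to a closed subset by at least the
square of the step length. -/
theorem infDist_sq_add_dist_sq_le_of_nearest {E : Type*} [NormedAddCommGroup E]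
    [InnerProductSpace ℝ E] [ProperSpace E] {K C : Set E} (hK : Convex ℝ K) (hC : IsClosed C)
    (hne : C.Nonempty) (hCK : C ⊆ K) {u p : E} (hp : p ∈ K)
    (hmin : ∀ w ∈ K, dist u p ≤ dist u w) :
    infDist p C ^ 2 + dist u p ^ 2 ≤ infDist u C ^ 2 := by
  obtain ⟨y, hy, hdist⟩ := hC.exists_infDist_eq_dist hne u
  have h1 := dist_sq_add_dist_sq_le_of_nearest hK hp hmin (hCK hy)
  have h2 : infDist p C ^ 2 ≤ dist p y ^ 2 :=
    pow_le_pow_left₀ infDist_nonneg (infDist_le_dist_of_mem hy) 2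
  rw [hdist]
  linarith

/-- The squared distance between two terms of a sequence, at most `m` steps apart, is at most
`m` times the sum of the `m` squared step lengths. -/
theorem dist_sq_le_mul_sum_dist_sq {E : Type*} [PseudoMetricSpace E] (x : ℕ → E) (k : ℕ)
    {l m : ℕ} (hl : l ≤ m) :
    dist (x k) (x (k + l)) ^ 2 ≤
      (m : ℝ) * ∑ j ∈ Finset.range m, dist (x (k + j)) (x (k + j + 1)) ^ 2 := by
  have h1 : dist (x k) (x (k + l)) ≤ ∑ j ∈ Finset.range m, dist (x (k + j)) (x (k + j + 1)) :=
    (dist_le_range_sum_dist (fun j => x (k + j)) l).trans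
      (Finset.sum_le_sum_of_subset_of_nonneg (Finset.range_subset_range.2 hl)
        fun _ _ _ => dist_nonneg)
  have h2 := sq_sum_le_card_mul_sum_sq (s := Finset.range m)
    (f := fun j => dist (x (k + j)) (x (k + j + 1)))
  rw [Finset.card_range] at h2
  exact (pow_le_pow_left₀ dist_nonneg h1 2).trans h2

/-- Every residue modulo `m` occurs in each window of `m` consecutive naturals. -/
theorem exists_lt_add_mod_eq {m i : ℕ} (k : ℕ) (hi : i < m) : ∃ l < m, (k + l) % m = i := by
  have hk : k % m < m := Nat.mod_lt k (by omega)
  refine ⟨(i + (m - k % m)) % m, Nat.mod_lt _ (by omega), ?_⟩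
  have : k + (i + (m - k % m)) = i + m * (k / m + 1) := by
    have := Nat.mod_add_div k m
    rw [mul_add]
    omega
  rw [Nat.add_mod_mod, this, Nat.add_mul_mod_self_left,
    Nat.mod_eq_of_lt hi]

/-- Cycle-decrease estimate for the cyclic projection algorithm under a Hölderian
regularity assumption (inequality (4.5) in the proof of Proposition 4.2). -/
theorem cyclic_projection_cycle_decrease
    (n m : ℕ) (hm : 0 < m)
    (D : Fin m → Set (EuclideanSpace ℝ (Fin n)))
    (hDne : ∀ i, (D i).Nonempty) (hDcl : ∀ i, IsClosed (D i))
    (hDcv : ∀ i, Convex ℝ (D i))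
    (hne : (⋂ i, D i).Nonempty)
    -- the sequence of cyclic projections: `x (k+1)` is the nearest point of
    -- `D (k % m)` to `x k`
    (x : ℕ → EuclideanSpace ℝ (Fin n))
    (hx : ∀ k : ℕ, x (k + 1) ∈ D ⟨k % m, Nat.mod_lt k hm⟩ ∧
      ∀ y ∈ D ⟨k % m, Nat.mod_lt k hm⟩, dist (x k) (x (k + 1)) ≤ dist (x k) y)
    (τ : ℝ) (hτ0 : 0 < τ) (hτ1 : τ ≤ 1)
    (r : ℝ) (hr : r = 1 / τ)
    (c₀ : ℝ) (hc₀ : 1 < c₀)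
    (hreg : ∀ k : ℕ, Metric.infDist (x k) (⋂ i, D i) ^ (2 : ℝ) ≤
      c₀ * (∑ i, Metric.infDist (x k) (D i) ^ (2 : ℝ)) ^ τ) :
    ∀ k : ℕ,
      (1 / c₀ ^ r) * Metric.infDist (x k) (⋂ i, D i) ^ (2 * r) ≤
        (m : ℝ) ^ 3 * (Metric.infDist (x k) (⋂ i, D i) ^ (2 : ℝ) -
          Metric.infDist (x (k + m)) (⋂ i, D i) ^ (2 : ℝ)) := by
  intro k
  set C : Set (EuclideanSpace ℝ (Fin n)) := ⋂ i, D i with hC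
  set S : ℝ := ∑ j ∈ Finset.range m, dist (x (k + j)) (x (k + j + 1)) ^ 2 with hS
  set A : ℝ := ∑ i, infDist (x k) (D i) ^ (2 : ℝ) with hA
  have hS0 : 0 ≤ S := Finset.sum_nonneg fun _ _ => sq_nonneg _
  have hA0 : 0 ≤ A := Finset.sum_nonneg fun _ _ => Real.rpow_nonneg infDist_nonneg _
  have hdec : S ≤ infDist (x k) C ^ 2 - infDist (x (k + m)) C ^ 2 := by
    have htel := Finset.sum_range_sub' (fun j => infDist (x (k + j)) C ^ 2) m
    rw [add_zero] at htel
    rw [← htel]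
    refine Finset.sum_le_sum fun j _ => ?_
    have := infDist_sq_add_dist_sq_le_of_nearest (hDcv _) (isClosed_iInter hDcl) hne
      (iInter_subset D _) (hx (k + j)).1 (hx (k + j)).2
    rw [← add_assoc]
    linarith
  have hAS : A ≤ (m : ℝ) ^ 2 * S := by
    have hterm : ∀ i ∈ Finset.univ, infDist (x k) (D i) ^ (2 : ℝ) ≤ (m : ℝ) * S := by
      intro i _
      obtain ⟨l, hl, hli⟩ := exists_lt_add_mod_eq k i.2
      have hmem : x (k + (l + 1)) ∈ D i := by
        have := (hx (k + l)).1
        simp only [hli] at this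
        exact this
      rw [Real.rpow_two]
      exact (pow_le_pow_left₀ infDist_nonneg (infDist_le_dist_of_mem hmem) 2).trans
        (dist_sq_le_mul_sum_dist_sq x k hl)
    have := Finset.sum_le_card_nsmul _ _ _ hterm
    rw [Finset.card_univ, Fintype.card_fin, nsmul_eq_mul] at this
    linarith
  have hm1 : (1 : ℝ) ≤ m := by exact_mod_cast hm
  have hr0 : 0 ≤ r := by rw [hr]; positivity
  have hc : 0 < c₀ := by linarith
  have hpow : infDist (x k) C ^ (2 * r) ≤ c₀ ^ r * A := by
    rw [Real.rpow_mul infDist_nonneg]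
    refine (Real.rpow_le_rpow (Real.rpow_nonneg infDist_nonneg _) (hreg k) hr0).trans ?_
    rw [Real.mul_rpow hc.le (Real.rpow_nonneg hA0 _), ← Real.rpow_mul hA0, hr,
      mul_one_div_cancel hτ0.ne', Real.rpow_one]
  calc (1 / c₀ ^ r) * infDist (x k) C ^ (2 * r) ≤ A := by
        rw [one_div, inv_mul_le_iff₀ (Real.rpow_pos_of_pos hc r)]
        exact hpow
    _ ≤ (m : ℝ) ^ 2 * S := hAS
    _ ≤ (m : ℝ) ^ 3 * S :=
        mul_le_mul_of_nonneg_right (pow_le_pow_right₀ hm1 (by norm_num)) hS0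
    _ ≤ _ := by
        rw [Real.rpow_two, Real.rpow_two]
        exact mul_le_mul_of_nonneg_left hdec (by positivity)
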